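/- Let n ≥ 8 and Ω ⊆ ℝⁿ be an open set. Then for every u ∈ C_0^∞(Ω) one has ∫_Ω |Δu|² dx ≥ (n²/4) · ∫_Ω |∇u(x)|²/|x|² dx. -/

import Mathlib

open MeasureTheory Real Set Filter
open scoped RealInnerProductSpace ENNReal

noncomputable section

/-- Euclidean `n`-space. -/
abbrev E (n : ℕ) := EuclideanSpace ℝ (Fin n)

/-- The Euclidean Laplacian of `u : E n → ℝ`. -/
def eLap {n : ℕ} (u : E n → ℝ) (x : E n) : ℝ :=
  ∑ i : Fin n, fderiv ℝ (fun y => fderiv ℝ u y (EuclideanSpace.single i 1)) x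
    (EuclideanSpace.single i 1)

/-- The radial derivative of `u` at `x` with respect to the base point `x₀`:
`⟨∇u(x), (x - x₀)/‖x - x₀‖⟩`. -/
def radDeriv {n : ℕ} (x₀ : E n) (u : E n → ℝ) (x : E n) : ℝ :=
  ⟪gradient u x, x - x₀⟫ / ‖x - x₀‖

/-- The `i`-th partial derivative of `u : E n → ℝ`. -/
def partialDeriv {n : ℕ} (u : E n → ℝ) (i : Fin n) (x : E n) : ℝ :=
  fderiv ℝ u x (EuclideanSpace.single i 1)

/-- The components of the vector field `⟨V, ∇u⟩ ∇u - |∇u|² V / 2`,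
where `V x = x / (‖x‖ ^ 2 + ε)`. -/
def pohozaevField {n : ℕ} (u : E n → ℝ) (ε : ℝ) (i : Fin n) (x : E n) : ℝ :=
  partialDeriv u i x * (∑ j, partialDeriv u j x * x j) * (‖x‖ ^ 2 + ε)⁻¹ -
    1 / 2 * (x i * (‖x‖ ^ 2 + ε)⁻¹ * ∑ j, partialDeriv u j x ^ 2)

theorem contDiff_partialDeriv {n : ℕ} {u : E n → ℝ} (hu : ContDiff ℝ (⊤ : ℕ∞) u) (i : Fin n) :
    ContDiff ℝ (⊤ : ℕ∞) (partialDeriv u i) :=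
  (hu.fderiv_right (m := (⊤ : ℕ∞)) (by simp)).clm_apply contDiff_const

theorem hasCompactSupport_partialDeriv {n : ℕ} {u : E n → ℝ} (hcs : HasCompactSupport u)
    (i : Fin n) : HasCompactSupport (partialDeriv u i) :=
  hcs.fderiv_apply ℝ _

theorem partialDeriv_comm {n : ℕ} {u : E n → ℝ} (hu : ContDiff ℝ (⊤ : ℕ∞) u) (i j : Fin n)
    (x : E n) : partialDeriv (partialDeriv u j) i x = partialDeriv (partialDeriv u i) j x := by
  have hd : DifferentiableAt ℝ (fderiv ℝ u) x :=
    ((hu.fderiv_right (m := (⊤ : ℕ∞)) (by simp)).differentiable (by simp)) x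
  have key : ∀ k l : Fin n, partialDeriv (partialDeriv u k) l x =
      fderiv ℝ (fderiv ℝ u) x (EuclideanSpace.single l 1) (EuclideanSpace.single k 1) := by
    intro k l
    have h := (hd.hasFDerivAt.clm_apply
      (hasFDerivAt_const (EuclideanSpace.single k (1 : ℝ)) x)).fderiv
    change fderiv ℝ (fun y => fderiv ℝ u y (EuclideanSpace.single k 1)) x _ = _
    rw [h]
    simp
  rw [key, key]
  exact ((contDiff_infty.1 hu 2).contDiffAt.isSymmSndFDerivAt (by simp)) _ _

theorem norm_gradient_sq {n : ℕ} (u : E n → ℝ) (x : E n) :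
    ‖gradient u x‖ ^ 2 = ∑ j, partialDeriv u j x ^ 2 := by
  rw [EuclideanSpace.norm_sq_eq]
  refine Finset.sum_congr rfl fun j _ => ?_
  have h : gradient u x j = partialDeriv u j x := by
    rw [partialDeriv, ← toDual_gradient, InnerProductSpace.toDual_apply_apply,
      EuclideanSpace.inner_single_right]
    simp
  rw [h, Real.norm_eq_abs, sq_abs]

theorem eLap_eq_sum {n : ℕ} (u : E n → ℝ) (x : E n) :
    eLap u x = ∑ i, partialDeriv (partialDeriv u i) i x := rfl

theorem contDiff_pohozaevField {n : ℕ} {u : E n → ℝ} (hu : ContDiff ℝ (⊤ : ℕ∞) u) {ε : ℝ}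
    (hε : 0 < ε) (i : Fin n) : ContDiff ℝ (⊤ : ℕ∞) (pohozaevField u ε i) := by
  have hp := fun j => contDiff_partialDeriv hu j
  have hx : ∀ j : Fin n, ContDiff ℝ (⊤ : ℕ∞) fun x : E n => x j := fun j =>
    (EuclideanSpace.proj (𝕜 := ℝ) j).contDiff
  have hw : ContDiff ℝ (⊤ : ℕ∞) fun x : E n => (‖x‖ ^ 2 + ε)⁻¹ :=
    ((contDiff_norm_sq ℝ).add contDiff_const).inv fun x => by positivity
  have hX : ContDiff ℝ (⊤ : ℕ∞) fun x : E n => ∑ j, partialDeriv u j x * x j :=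
    ContDiff.sum fun j _ => (hp j).mul (hx j)
  have hG : ContDiff ℝ (⊤ : ℕ∞) fun x : E n => ∑ j, partialDeriv u j x ^ 2 :=
    ContDiff.sum fun j _ => (hp j).pow 2
  exact (((hp i).mul hX).mul hw).sub (contDiff_const.mul (((hx i).mul hw).mul hG))

theorem hasCompactSupport_sum_sq_partialDeriv {n : ℕ} {u : E n → ℝ} (hcs : HasCompactSupport u) :
    HasCompactSupport fun x => ∑ j, partialDeriv u j x ^ 2 := by
  refine (hcs.fderiv ℝ).mono fun x hx => ?_
  contrapose! hx
  simp only [Function.mem_support, not_not] at hx ⊢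
  simp [partialDeriv, hx]

theorem hasCompactSupport_pohozaevField {n : ℕ} {u : E n → ℝ} (hcs : HasCompactSupport u) (ε : ℝ)
    (i : Fin n) : HasCompactSupport (pohozaevField u ε i) := by
  refine (hcs.fderiv ℝ).mono fun x hx => ?_
  contrapose! hx
  simp only [Function.mem_support, not_not] at hx ⊢
  simp [pohozaevField, partialDeriv, hx]

theorem integrable_partialDeriv {n : ℕ} {f : E n → ℝ} (hf : ContDiff ℝ (⊤ : ℕ∞) f)
    (hcs : HasCompactSupport f) (i : Fin n) : Integrable (partialDeriv f i) :=
  (contDiff_partialDeriv hf i).continuous.integrable_of_hasCompactSupport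
    (hasCompactSupport_partialDeriv hcs i)

theorem integral_partialDeriv_eq_zero {n : ℕ} {f : E n → ℝ} (hf : ContDiff ℝ (⊤ : ℕ∞) f)
    (hcs : HasCompactSupport f) (i : Fin n) : ∫ x, partialDeriv f i x = 0 := by
  have h := integral_mul_fderiv_eq_neg_fderiv_mul_of_integrable (μ := (volume : Measure (E n)))
    (f := fun _ => (1 : ℝ)) (g := f) (v := EuclideanSpace.single i 1)
    (by simp) (by simp only [one_mul]; exact integrable_partialDeriv hf hcs i)
    (by simpa using hf.continuous.integrable_of_hasCompactSupport hcs)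
    (fun x _ => by fun_prop) (fun x _ => hf.differentiable (by simp) x)
  simpa [partialDeriv] using h

theorem partialDeriv_pohozaevField {n : ℕ} {u : E n → ℝ} (hu : ContDiff ℝ (⊤ : ℕ∞) u) {ε : ℝ}
    (hε : 0 < ε) (i : Fin n) (x : E n) :
    partialDeriv (pohozaevField u ε i) i x =
      partialDeriv (partialDeriv u i) i x * (∑ j, partialDeriv u j x * x j) * (‖x‖ ^ 2 + ε)⁻¹
      + partialDeriv u i x * (∑ j, partialDeriv (partialDeriv u j) i x * x j + partialDeriv u i x)
        * (‖x‖ ^ 2 + ε)⁻¹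
      + partialDeriv u i x * (∑ j, partialDeriv u j x * x j) *
        (-(2 * x i) * ((‖x‖ ^ 2 + ε)⁻¹) ^ 2)
      - 1 / 2 * (((‖x‖ ^ 2 + ε)⁻¹ + x i * (-(2 * x i) * ((‖x‖ ^ 2 + ε)⁻¹) ^ 2)) *
          (∑ j, partialDeriv u j x ^ 2)
        + x i * (‖x‖ ^ 2 + ε)⁻¹ *
          ∑ j, 2 * partialDeriv u j x * partialDeriv (partialDeriv u j) i x) := by
  set e : E n := EuclideanSpace.single i 1 with he
  have hline : ∀ f : E n → ℝ, ContDiff ℝ (⊤ : ℕ∞) f →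
      HasDerivAt (fun t : ℝ => f (x + t • e)) (partialDeriv f i x) 0 := fun f hf =>
    (hf.differentiable (by simp) x).hasFDerivAt.hasLineDerivAt e
  have hp : ∀ j, HasDerivAt (fun t : ℝ => partialDeriv u j (x + t • e))
      (partialDeriv (partialDeriv u j) i x) 0 := fun j => hline _ (contDiff_partialDeriv hu j)
  have hx : ∀ j, HasDerivAt (fun t : ℝ => (x + t • e) j) (e j) 0 := fun j => by
    have := ((hasDerivAt_id (0 : ℝ)).mul_const (e j)).const_add (x j)
    simpa using this
  have hei : e i = 1 := by simp [he]
  have hN : HasDerivAt (fun t : ℝ => ‖x + t • e‖ ^ 2) (2 * x i) 0 := by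
    have h : HasDerivAt (fun t : ℝ => x + t • e) e 0 := by
      simpa using ((hasDerivAt_id (0 : ℝ)).smul_const e).const_add x
    have := h.norm_sq
    simpa [he, EuclideanSpace.inner_single_right] using this
  have hw : HasDerivAt (fun t : ℝ => (‖x + t • e‖ ^ 2 + ε)⁻¹)
      (-(2 * x i) * ((‖x‖ ^ 2 + ε)⁻¹) ^ 2) 0 := by
    refine ((hN.add_const ε).fun_inv (by positivity)).congr_deriv ?_
    simp [div_eq_mul_inv]
  have hX : HasDerivAt (fun t : ℝ => ∑ j, partialDeriv u j (x + t • e) * (x + t • e) j)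
      (∑ j, partialDeriv (partialDeriv u j) i x * x j + partialDeriv u i x) 0 := by
    refine (HasDerivAt.fun_sum fun j _ => (hp j).fun_mul (hx j)).congr_deriv ?_
    simp [Finset.sum_add_distrib, he, PiLp.single_apply]
  have hG : HasDerivAt (fun t : ℝ => ∑ j, partialDeriv u j (x + t • e) ^ 2)
      (∑ j, 2 * partialDeriv u j x * partialDeriv (partialDeriv u j) i x) 0 := by
    refine (HasDerivAt.fun_sum fun j _ => (hp j).fun_pow 2).congr_deriv ?_
    simp
  have h := (((hp i).fun_mul hX).fun_mul hw).fun_sub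
    (((((hx i).fun_mul hw).fun_mul hG)).const_mul (1 / 2))
  refine (hline _ (contDiff_pohozaevField hu hε i)).unique (h.congr_deriv ?_)
  simp only [zero_smul, add_zero, hei]
  ring

theorem sum_partialDeriv_pohozaevField {n : ℕ} {u : E n → ℝ} (hu : ContDiff ℝ (⊤ : ℕ∞) u) {ε : ℝ}
    (hε : 0 < ε) (x : E n) :
    ∑ i, partialDeriv (pohozaevField u ε i) i x =
      eLap u x * ((∑ j, partialDeriv u j x * x j) * (‖x‖ ^ 2 + ε)⁻¹)
      + ((‖x‖ ^ 2 + ε)⁻¹ - n / 2 * (‖x‖ ^ 2 + ε)⁻¹ + ‖x‖ ^ 2 * ((‖x‖ ^ 2 + ε)⁻¹) ^ 2) *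
        (∑ j, partialDeriv u j x ^ 2)
      - 2 * ((∑ j, partialDeriv u j x * x j) * (‖x‖ ^ 2 + ε)⁻¹) ^ 2 := by
  have hnorm : ‖x‖ ^ 2 = ∑ i, x i ^ 2 := by simp [EuclideanSpace.norm_sq_eq]
  have hsymm : ∑ i, partialDeriv u i x * ∑ j, partialDeriv (partialDeriv u j) i x * x j =
      ∑ i, x i * ∑ j, partialDeriv u j x * partialDeriv (partialDeriv u j) i x := by
    simp only [Finset.mul_sum]
    rw [Finset.sum_comm]
    refine Finset.sum_congr rfl fun i _ => Finset.sum_congr rfl fun j _ => ?_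
    rw [partialDeriv_comm hu j i]
    ring
  simp only [partialDeriv_pohozaevField hu hε]
  set w := (‖x‖ ^ 2 + ε)⁻¹
  set X := ∑ j, partialDeriv u j x * x j with hX
  set G := ∑ j, partialDeriv u j x ^ 2 with hG
  have hsplit : ∀ i, partialDeriv (partialDeriv u i) i x * X * w
      + partialDeriv u i x * (∑ j, partialDeriv (partialDeriv u j) i x * x j + partialDeriv u i x)
        * w
      + partialDeriv u i x * X * (-(2 * x i) * w ^ 2)
      - 1 / 2 * ((w + x i * (-(2 * x i) * w ^ 2)) * G
        + x i * w * ∑ j, 2 * partialDeriv u j x * partialDeriv (partialDeriv u j) i x)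
      = partialDeriv (partialDeriv u i) i x * (X * w)
      + w * (partialDeriv u i x * ∑ j, partialDeriv (partialDeriv u j) i x * x j)
      + w * partialDeriv u i x ^ 2 - 2 * X * w ^ 2 * (partialDeriv u i x * x i)
      - 1 / 2 * w * G + w ^ 2 * G * x i ^ 2
      - w * (x i * ∑ j, partialDeriv u j x * partialDeriv (partialDeriv u j) i x) := by
    intro i
    simp only [mul_assoc, ← Finset.mul_sum]
    ring
  simp only [hsplit, Finset.sum_add_distrib, Finset.sum_sub_distrib, ← Finset.mul_sum,
    ← Finset.sum_mul, hsymm, ← hX, ← hG, ← hnorm, ← eLap_eq_sum]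
  simp
  ring

theorem hardyRellich_pointwise {n : ℕ} (hn : 8 ≤ n) {u : E n → ℝ}
    (hu : ContDiff ℝ (⊤ : ℕ∞) u) {ε : ℝ} (hε : 0 < ε) (x : E n) :
    n * ∑ i, partialDeriv (pohozaevField u ε i) i x +
      (n : ℝ) ^ 2 / 4 * ((∑ j, partialDeriv u j x ^ 2) * (‖x‖ ^ 2 + ε)⁻¹) ≤ eLap u x ^ 2 := by
  rw [sum_partialDeriv_pohozaevField hu hε]
  have hCS : (∑ j, partialDeriv u j x * x j) ^ 2 ≤ (∑ j, partialDeriv u j x ^ 2) * ‖x‖ ^ 2 := by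
    have hnorm : ‖x‖ ^ 2 = ∑ i, x i ^ 2 := by simp [EuclideanSpace.norm_sq_eq]
    rw [hnorm]
    exact Finset.sum_mul_sq_le_sq_mul_sq _ _ _
  have hG : 0 ≤ ∑ j, partialDeriv u j x ^ 2 := Finset.sum_nonneg fun j _ => sq_nonneg _
  have hw : 0 < (‖x‖ ^ 2 + ε)⁻¹ := by positivity
  have hNw : ‖x‖ ^ 2 * (‖x‖ ^ 2 + ε)⁻¹ ≤ 1 := by
    rw [← div_eq_mul_inv, div_le_one (by positivity)]
    linarith
  have hn' : (8 : ℝ) ≤ n := by exact_mod_cast hn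
  generalize (‖x‖ ^ 2 + ε)⁻¹ = w at *
  generalize ‖x‖ ^ 2 = N at *
  generalize (∑ j, partialDeriv u j x ^ 2) = G at *
  generalize (∑ j, partialDeriv u j x * x j) = X at *
  generalize eLap u x = L at *
  generalize (n : ℝ) = m at *
  have h1 : N * w ^ 2 * G ≤ w * G := by
    have := mul_le_mul_of_nonneg_right hNw (mul_nonneg hw.le hG)
    linarith
  have h2 : (X * w) ^ 2 ≤ w * G := by
    have := mul_le_mul_of_nonneg_right hCS (sq_nonneg w)
    linarith
  have h3 : 0 ≤ m * (m - 8) * (w * G - (X * w) ^ 2) :=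
    mul_nonneg (mul_nonneg (by linarith) (by linarith)) (by linarith)
  have h4 : 0 ≤ m * (w * G - N * w ^ 2 * G) := mul_nonneg (by linarith) (by linarith)
  nlinarith [sq_nonneg (L - m / 2 * (X * w))]

theorem hardyRellich_regularized {n : ℕ} (hn : 8 ≤ n) {u : E n → ℝ}
    (hu : ContDiff ℝ (⊤ : ℕ∞) u) (hcs : HasCompactSupport u) {ε : ℝ} (hε : 0 < ε) :
    (n : ℝ) ^ 2 / 4 * ∫ x, ‖gradient u x‖ ^ 2 * (‖x‖ ^ 2 + ε)⁻¹ ≤ ∫ x, eLap u x ^ 2 := by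
  simp only [norm_gradient_sq]
  have hF := fun i => integrable_partialDeriv (contDiff_pohozaevField hu hε i)
    (hasCompactSupport_pohozaevField hcs ε i) i
  have hdiv : Integrable fun x => ∑ i, partialDeriv (pohozaevField u ε i) i x :=
    integrable_finsetSum _ fun i _ => hF i
  have hdiv0 : ∫ x, ∑ i, partialDeriv (pohozaevField u ε i) i x = 0 := by
    rw [integral_finsetSum _ fun i _ => hF i]
    exact Finset.sum_eq_zero fun i _ => integral_partialDeriv_eq_zero
      (contDiff_pohozaevField hu hε i) (hasCompactSupport_pohozaevField hcs ε i) i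
  have hG : Integrable fun x => (∑ j, partialDeriv u j x ^ 2) * (‖x‖ ^ 2 + ε)⁻¹ := by
    refine Continuous.integrable_of_hasCompactSupport ?_
      (hasCompactSupport_sum_sq_partialDeriv hcs).mul_right
    have hp := fun j => (contDiff_partialDeriv hu j).continuous
    refine (continuous_finsetSum _ fun j _ => (hp j).pow 2).mul
      (Continuous.inv₀ (by fun_prop) fun x => by positivity)
  have hL : Integrable fun x => eLap u x ^ 2 := by
    have hc : Continuous (eLap u) := continuous_finsetSum _ fun i _ =>
      (contDiff_partialDeriv (contDiff_partialDeriv hu i) i).continuous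
    refine (hc.pow 2).integrable_of_hasCompactSupport ((hcs.fderiv ℝ |>.fderiv ℝ).mono ?_)
    intro x hx
    contrapose! hx
    simp only [Function.mem_support, not_not] at hx ⊢
    have hd : DifferentiableAt ℝ (fderiv ℝ u) x :=
      ((hu.fderiv_right (m := (⊤ : ℕ∞)) (by simp)).differentiable (by simp)) x
    have : eLap u x = 0 := Finset.sum_eq_zero fun i _ => by
      rw [(hd.hasFDerivAt.clm_apply
        (hasFDerivAt_const (EuclideanSpace.single i (1 : ℝ)) x)).fderiv]
      simp [hx]
    simp [this]
  have h := integral_mono ((hdiv.const_mul (n : ℝ)).add (hG.const_mul ((n : ℝ) ^ 2 / 4))) hL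
    (hardyRellich_pointwise hn hu hε)
  simp only [Pi.add_apply] at h
  rwa [integral_add (hdiv.const_mul _) (hG.const_mul _), integral_const_mul, integral_const_mul,
    hdiv0, mul_zero, zero_add] at h

theorem hardyRellich {n : ℕ} (hn : 8 ≤ n) {u : E n → ℝ}
    (hu : ContDiff ℝ (⊤ : ℕ∞) u) (hcs : HasCompactSupport u) :
    (n : ℝ) ^ 2 / 4 * ∫ x, ‖gradient u x‖ ^ 2 / ‖x‖ ^ 2 ≤ ∫ x, eLap u x ^ 2 := by
  by_cases hint : Integrable fun x => ‖gradient u x‖ ^ 2 / ‖x‖ ^ 2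
  swap
  · rw [integral_undef hint, mul_zero]
    exact integral_nonneg fun x => sq_nonneg _
  have : Nonempty (Fin n) := ⟨⟨0, by omega⟩⟩
  have hne : ∀ᵐ x : E n, x ≠ 0 := by
    simp [ae_iff]
  have hlim : Tendsto (fun ε : ℝ => ∫ x, ‖gradient u x‖ ^ 2 * (‖x‖ ^ 2 + ε)⁻¹)
      (nhdsWithin 0 (Ioi 0)) (nhds (∫ x, ‖gradient u x‖ ^ 2 / ‖x‖ ^ 2)) := by
    refine tendsto_integral_filter_of_dominated_convergence _ ?_ ?_ hint ?_
    · filter_upwards [self_mem_nhdsWithin] with ε hε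
      have hε : 0 < ε := hε
      have hp := fun j => (contDiff_partialDeriv hu j).continuous
      simp only [norm_gradient_sq]
      exact ((continuous_finsetSum _ fun j _ => (hp j).pow 2).mul
        (Continuous.inv₀ (by fun_prop) fun x => by positivity)).aestronglyMeasurable
    · filter_upwards [self_mem_nhdsWithin] with ε hε
      have hε : 0 < ε := hε
      filter_upwards [hne] with x hx
      have hx' : 0 < ‖x‖ := norm_pos_iff.2 hx
      rw [Real.norm_of_nonneg (by positivity), div_eq_mul_inv]
      gcongr
      linarith
    · filter_upwards [hne] with x hx
      have hx' : 0 < ‖x‖ := norm_pos_iff.2 hx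
      have hc : ContinuousAt (fun ε : ℝ => ‖gradient u x‖ ^ 2 * (‖x‖ ^ 2 + ε)⁻¹) 0 :=
        continuousAt_const.mul (ContinuousAt.inv₀ (by fun_prop) (by positivity))
      have := hc.tendsto.mono_left (nhdsWithin_le_nhds (s := Ioi 0))
      simpa [div_eq_mul_inv] using this
  refine le_of_tendsto (hlim.const_mul _) ?_
  filter_upwards [self_mem_nhdsWithin] with ε hε
  exact hardyRellich_regularized hn hu hcs hε

theorem stmt_3 (n : ℕ) (hn : 8 ≤ n) (Ω : Set (E n)) (hΩ : IsOpen Ω)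
    (u : E n → ℝ) (hu : ContDiff ℝ (⊤ : ℕ∞) u) (hcs : HasCompactSupport u)
    (hsupp : tsupport u ⊆ Ω) :
    ∫ x in Ω, (eLap u x) ^ 2 ≥ (n : ℝ) ^ 2 / 4 * ∫ x in Ω, ‖gradient u x‖ ^ 2 / ‖x‖ ^ 2 := by
  have hzero : ∀ x, x ∉ Ω → fderiv ℝ u =ᶠ[nhds x] 0 := fun x hx => by
    have h : x ∉ tsupport (fderiv ℝ u) := fun h => hx (hsupp (tsupport_fderiv_subset ℝ h))
    exact notMem_tsupport_iff_eventuallyEq.1 h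
  rw [setIntegral_eq_integral_of_forall_compl_eq_zero,
    setIntegral_eq_integral_of_forall_compl_eq_zero]
  · exact hardyRellich hn hu hcs
  · intro x hx
    have h := (hzero x hx).eq_of_nhds
    simp [norm_gradient_sq, partialDeriv, h]
  · intro x hx
    have h : eLap u x = 0 := Finset.sum_eq_zero fun i _ => by
      have hi : (fun y => fderiv ℝ u y (EuclideanSpace.single i 1)) =ᶠ[nhds x] fun _ => 0 := by
        filter_upwards [hzero x hx] with y hy
        simp [hy]
      rw [hi.fderiv_eq]
      simp
    simp [h]
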